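/- Let X, Y be normed spaces, S : X → Y a bounded linear operator, F the unit ball of X, and N : F → ℝ^n a continuous map. Then for every (n+1)-dimensional subspace V ⊆ X there exists f ∈ V with ‖f‖_X = 1 and N(f) = N(−f). -/

import Mathlib

/-- Mod 2 chains of simplices of all dimensions, a simplex being the list of its vertices. -/
abbrev ListChain (E : Type*) := List E →₀ ZMod 2

namespace ListChain

open Finsupp

section Combinatorics

variable {E : Type*}

/-- The chains all of whose simplices lie in `s`. -/
abbrev supp (s : Set (List E)) : Submodule (ZMod 2) (ListChain E) :=
  supported (ZMod 2) (ZMod 2) s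

/-- The simplex spanned by a list of vertices. -/
noncomputable abbrev simplex (l : List E) : ListChain E := single l 1

theorem map_mem_of_supp {M : Type*} [AddCommGroup M] [Module (ZMod 2) M]
    {s : Set (List E)} {T : ListChain E →ₗ[ZMod 2] M} {p : Submodule (ZMod 2) M}
    (h : ∀ l ∈ s, T (simplex l) ∈ p) {c : ListChain E} (hc : c ∈ supp s) : T c ∈ p := by
  have : supp s ≤ p.comap T := by
    rw [supp, supported_eq_span_single, Submodule.span_le]
    rintro _ ⟨l, hl, rfl⟩
    exact h l hl
  exact this hc

theorem map_eq_of_supp {M : Type*} [AddCommGroup M] [Module (ZMod 2) M]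
    {s : Set (List E)} {T T' : ListChain E →ₗ[ZMod 2] M}
    (h : ∀ l ∈ s, T (simplex l) = T' (simplex l)) {c : ListChain E} (hc : c ∈ supp s) :
    T c = T' c := by
  have : (T - T') c ∈ (⊥ : Submodule (ZMod 2) M) :=
    map_mem_of_supp (fun l hl => by simp [h l hl]) hc
  simpa [sub_eq_zero] using this

theorem simplex_mem_supp {s : Set (List E)} {l : List E} (h : l ∈ s) : simplex l ∈ supp s :=
  single_mem_supported _ _ h

theorem add_self_eq_zero' {M : Type*} [AddCommGroup M] [Module (ZMod 2) M] (x : M) :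
    x + x = 0 := by
  rw [← two_smul (ZMod 2) x, show (2 : ZMod 2) = 0 from rfl, zero_smul]

/-- Adding the vertex `a` to every simplex. -/
noncomputable def cone (a : E) : ListChain E →ₗ[ZMod 2] ListChain E :=
  lmapDomain _ _ (List.cons a)

@[simp] theorem cone_simplex (a : E) (l : List E) : cone a (simplex l) = simplex (a :: l) := by
  simp [cone]

theorem cone_mem {s t : Set (List E)} {a : E} (h : ∀ l ∈ s, a :: l ∈ t) {c : ListChain E}
    (hc : c ∈ supp s) : cone a c ∈ supp t :=
  map_mem_of_supp (fun l hl => by rw [cone_simplex]; exact simplex_mem_supp (h l hl)) hc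

/-- The sum of the facets of a simplex, in the augmented complex. -/
noncomputable def facets : List E → ListChain E
  | [] => 0
  | a :: l => simplex l + cone a (facets l)

/-- The boundary operator of the augmented complex. -/
noncomputable def boundary : ListChain E →ₗ[ZMod 2] ListChain E :=
  linearCombination (ZMod 2) facets

@[simp] theorem boundary_simplex (l : List E) : boundary (simplex l) = facets l := by
  simp [boundary]

theorem boundary_cone (a : E) (c : ListChain E) :
    boundary (cone a c) = c + cone a (boundary c) := by
  have := map_eq_of_supp (s := Set.univ) (T := boundary ∘ₗ cone a)
    (T' := LinearMap.id + cone a ∘ₗ boundary) (c := c) (fun l _ => by simp [facets])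
    (by simp)
  simpa using this

theorem boundary_facets (l : List E) : boundary (facets l) = 0 := by
  induction l with
  | nil => simp [facets]
  | cons a l ih =>
    rw [facets, map_add, boundary_cone, ih, boundary_simplex, map_zero, add_zero,
      add_self_eq_zero']

theorem facets_mem (l : List E) :
    facets l ∈ supp {l' | l'.length + 1 = l.length ∧ ∀ x ∈ l', x ∈ l} := by
  induction l with
  | nil => simp [facets]
  | cons a l ih =>
    refine add_mem (simplex_mem_supp ⟨rfl, fun x hx => List.mem_cons_of_mem _ hx⟩)
      (cone_mem ?_ ih)
    rintro l' ⟨h, h'⟩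
    refine ⟨by simp [h], ?_⟩
    intro x hx
    rcases List.mem_cons.1 hx with rfl | hx
    · simp
    · exact List.mem_cons_of_mem _ (h' x hx)

theorem boundary_mem_length {k : ℕ} {c : ListChain E} (hc : c ∈ supp {l | l.length = k + 1}) :
    boundary c ∈ supp {l | l.length = k} := by
  refine map_mem_of_supp (fun l hl => ?_) hc
  rw [boundary_simplex]
  refine supported_mono ?_ (facets_mem l)
  rintro l' ⟨h, -⟩
  simp only [Set.mem_ofPred_eq] at hl ⊢
  omega

/-- The cup product of the coboundaries of the `0`-cochains `σ 0, σ 1, …`, evaluated on a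
simplex. The vertices are numbered from the end of the list. -/
def cupVal (σ : ℕ → E → ZMod 2) : List E → ZMod 2
  | [] => 0
  | [_] => 1
  | x :: y :: l => (σ l.length x + σ l.length y) * cupVal σ (y :: l)

/-- The last factor of the cup product is replaced by a primitive. -/
def primVal (σ : ℕ → E → ZMod 2) : List E → ZMod 2
  | [] => 0
  | x :: l => σ l.length x * cupVal σ (x :: l)

/-- Linear extension of `cupVal`. -/
noncomputable def cup (σ : ℕ → E → ZMod 2) : ListChain E →ₗ[ZMod 2] ZMod 2 :=
  linearCombination (ZMod 2) (cupVal σ)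

/-- Linear extension of `primVal`. -/
noncomputable def prim (σ : ℕ → E → ZMod 2) : ListChain E →ₗ[ZMod 2] ZMod 2 :=
  linearCombination (ZMod 2) (primVal σ)

@[simp] theorem cup_simplex (σ : ℕ → E → ZMod 2) (l : List E) :
    cup σ (simplex l) = cupVal σ l := by simp [cup]

@[simp] theorem prim_simplex (σ : ℕ → E → ZMod 2) (l : List E) :
    prim σ (simplex l) = primVal σ l := by simp [prim]

theorem prim_cone (σ : ℕ → E → ZMod 2) (x : E) {k : ℕ} {c : ListChain E}
    (hc : c ∈ supp {l | l.length = k}) : prim σ (cone x c) = σ k x * cup σ (cone x c) := by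
  have := map_eq_of_supp (T := prim σ ∘ₗ cone x) (T' := σ k x • (cup σ ∘ₗ cone x))
    (fun l (hl : l.length = k) => by simp [primVal, hl]) hc
  simpa using this

theorem prim_facets (σ : ℕ → E → ZMod 2) (k : ℕ) :
    ∀ l : List E, l.length = k + 2 → prim σ (facets l) = cupVal σ l := by
  induction k with
  | zero =>
    intro l hl
    match l, hl with
    | [x, y], _ => simp [facets, primVal, cupVal, add_comm]
  | succ k ih =>
    intro l hl
    have hcl : cup σ (facets l) = 0 := by
      have h : facets l ∈ supp {l' : List E | l'.length = k + 2} :=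
        supported_mono (fun l' h => by have := h.1; simp only [Set.mem_ofPred_eq]; omega)
          (facets_mem l)
      have := map_eq_of_supp (T := cup σ) (T' := prim σ ∘ₗ boundary)
        (fun l' hl' => by simp [ih l' hl']) h
      rw [this, LinearMap.comp_apply, boundary_facets, map_zero]
    match l, hl with
    | x :: y :: l, hl =>
      have hl' : l.length = k + 1 := by simpa using hl
      have hf : facets (y :: l) ∈ supp {l' : List E | l'.length = k + 1} :=
        supported_mono (fun l' h => by
          have := h.1; simp only [Set.mem_ofPred_eq, List.length_cons] at this ⊢; omega)
          (facets_mem (y :: l))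
      rw [facets, map_add, cup_simplex] at hcl
      rw [facets, map_add, prim_cone σ x hf, prim_simplex, primVal, cupVal, hl']
      have : cup σ (cone x (facets (y :: l))) = cupVal σ (y :: l) := by
        have h2 := CharTwo.add_self_eq_zero (cupVal σ (y :: l))
        linear_combination hcl - h2
      rw [this]
      ring

theorem prim_boundary (σ : ℕ → E → ZMod 2) {k : ℕ} {c : ListChain E}
    (hc : c ∈ supp {l | l.length = k + 2}) : prim σ (boundary c) = cup σ c :=
  map_eq_of_supp (T := prim σ ∘ₗ boundary) (T' := cup σ)
    (fun l hl => by simp [prim_facets σ k l hl]) hc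

theorem cupVal_eq_zero (σ : ℕ → E → ZMod 2) {k : ℕ} (l : List E) (hk : k + 1 < l.length)
    (h : ∀ x ∈ l, ∀ y ∈ l, σ k x = σ k y) : cupVal σ l = 0 := by
  induction l with
  | nil => rfl
  | cons x l ih =>
    match l, hk with
    | y :: l, hk =>
      rw [cupVal]
      rcases eq_or_ne k l.length with rfl | hne
      · rw [h x (by simp) y (by simp), CharTwo.add_self_eq_zero, zero_mul]
      · rw [ih, mul_zero]
        · simp only [List.length_cons] at hk ⊢; omega
        · exact fun a ha b hb => h a (List.mem_cons_of_mem _ ha) b (List.mem_cons_of_mem _ hb)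

section Antipode

variable [AddCommGroup E]

/-- The map induced on chains by `x ↦ -x`. -/
noncomputable def antipode : ListChain E →ₗ[ZMod 2] ListChain E :=
  lmapDomain _ _ (List.map Neg.neg)

@[simp] theorem antipode_simplex (l : List E) :
    antipode (simplex l) = simplex (l.map Neg.neg) := by simp [antipode]

theorem antipode_cone (a : E) (c : ListChain E) :
    antipode (cone a c) = cone (-a) (antipode c) := by
  have := map_eq_of_supp (s := Set.univ) (T := antipode ∘ₗ cone a)
    (T' := cone (-a) ∘ₗ antipode) (c := c) (fun l _ => by simp) (by simp)
  simpa using this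

theorem antipode_facets (l : List E) : antipode (facets l) = facets (l.map Neg.neg) := by
  induction l with
  | nil => simp [facets]
  | cons a l ih => simp only [facets, map_add, antipode_simplex, antipode_cone, ih, List.map_cons]

theorem cupVal_map_neg (σ : ℕ → E → ZMod 2) (l : List E)
    (h : ∀ x ∈ l, ∀ k, σ k x + σ k (-x) = 1) : cupVal σ (l.map Neg.neg) = cupVal σ l := by
  induction l with
  | nil => rfl
  | cons x l ih =>
    cases l with
    | nil => rfl
    | cons y l =>
      have ih' := ih (fun z hz => h z (List.mem_cons_of_mem _ hz))
      simp only [List.map_cons, cupVal, List.length_map] at ih' ⊢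
      rw [ih']
      congr 1
      have hx := h x (by simp) l.length
      have hy := h y (by simp) l.length
      have h1 := CharTwo.add_self_eq_zero (σ l.length x)
      have h2 := CharTwo.add_self_eq_zero (σ l.length y)
      have h3 := CharTwo.add_self_eq_zero (1 : ZMod 2)
      linear_combination hx + hy - h1 - h2 + h3

theorem prim_add_antipode (σ : ℕ → E → ZMod 2) {c : ListChain E}
    (hc : c ∈ supp {l | l ≠ [] ∧ ∀ x ∈ l, ∀ k, σ k x + σ k (-x) = 1}) :
    prim σ (c + antipode c) = cup σ c := by
  rw [map_add]
  refine map_eq_of_supp (T := prim σ + prim σ ∘ₗ antipode) (T' := cup σ) ?_ hc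
  rintro l ⟨hl, h⟩
  have hneg := cupVal_map_neg σ l h
  match l, hl with
  | x :: l, _ =>
    have hx := h x (by simp) l.length
    simp only [List.map_cons] at hneg
    simp only [LinearMap.add_apply, LinearMap.comp_apply, prim_simplex, antipode_simplex,
      List.map_cons, primVal, cup_simplex, List.length_map, hneg]
    linear_combination cupVal σ (x :: l) * hx

/-- A tower of chains modelled on the hemispheres of the spheres has nonzero cup product. -/
theorem cup_hemisphere (σ : ℕ → E → ZMod 2) (H : ℕ → ListChain E) {n : ℕ}
    (hH : ∀ i ≤ n, H i ∈ supp {l | l.length = i + 1 ∧ ∀ x ∈ l, ∀ k, σ k x + σ k (-x) = 1})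
    (hbd : ∀ i < n, boundary (H (i + 1)) = H i + antipode (H i))
    (h0 : cup σ (H 0) = 1) : ∀ i ≤ n, cup σ (H i) = 1 := by
  intro i
  induction i with
  | zero => exact fun _ => h0
  | succ i ih =>
    intro hi
    rw [← prim_boundary σ (k := i) (supported_mono (fun l h => h.1) (hH (i + 1) hi)),
      hbd i hi, prim_add_antipode, ih (by omega)]
    refine supported_mono ?_ (hH i (by omega))
    rintro l ⟨h, h'⟩
    exact ⟨fun h0 => by simp [h0] at h, h'⟩

end Antipode

end Combinatorics

section Subdivision

variable {E : Type*} [NormedAddCommGroup E] [NormedSpace ℝ E]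

/-- The barycenter of a list of points. -/
noncomputable def bary (l : List E) : E := (l.length : ℝ)⁻¹ • l.sum

theorem bary_map_neg (l : List E) : bary (l.map Neg.neg) = -bary l := by
  have : (l.map Neg.neg).sum = -l.sum := by
    induction l with
    | nil => simp
    | cons a l ih => simp only [List.map_cons, List.sum_cons, ih]; abel
  simp [bary, this]

theorem bary_mem {K : Set E} (hK : Convex ℝ K) {l : List E} (hl : l ≠ [])
    (h : ∀ x ∈ l, x ∈ K) : bary l ∈ K := by
  have hpos : (0 : ℝ) < l.length := by exact_mod_cast List.length_pos_iff.2 hl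
  have hsum : bary l = ∑ i : Fin l.length, (l.length : ℝ)⁻¹ • l.get i := by
    rw [← Finset.smul_sum, bary]
    congr 1
    simp [← List.sum_ofFn]
  rw [hsum]
  refine hK.sum_mem (fun _ _ => by positivity) ?_ (fun i _ => h _ (List.get_mem l i))
  simp [hpos.ne']

theorem dist_bary_le {l : List E} {d : ℝ} (h : ∀ x ∈ l, ∀ y ∈ l, dist x y ≤ d) {n : ℕ}
    (hn : l.length ≤ n + 1) {v : E} (hv : v ∈ l) : dist v (bary l) ≤ n / (n + 1) * d := by
  have key : ∀ t : List E, (∀ x ∈ t, dist x v ≤ d) →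
      ‖t.sum - (t.length : ℝ) • v‖ ≤ t.length * d := by
    intro t
    induction t with
    | nil => simp
    | cons x t ih =>
      intro ht
      have h1 := ih (fun y hy => ht y (List.mem_cons_of_mem _ hy))
      have h2 := ht x (by simp)
      rw [dist_eq_norm] at h2
      calc ‖(x :: t).sum - ((x :: t).length : ℝ) • v‖
          = ‖(x - v) + (t.sum - (t.length : ℝ) • v)‖ := by
            congr 1
            simp only [List.sum_cons, List.length_cons, Nat.cast_add, Nat.cast_one, add_smul,
              one_smul]
            abel
        _ ≤ d + t.length * d := (norm_add_le _ _).trans (add_le_add h2 h1)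
        _ = _ := by push_cast [List.length_cons]; ring
  have hd : 0 ≤ d := by simpa using h v hv v hv
  obtain ⟨s, t, rfl⟩ := List.append_of_mem hv
  have hst := key (s ++ t) (fun x hx => h x (by
    rcases List.mem_append.1 hx with hx | hx <;> simp [hx]) v hv)
  set m := (s ++ t).length with hm
  have hlen : (s ++ v :: t).length = m + 1 := by simp [hm]; omega
  have hmn : (m : ℝ) ≤ n := by
    have : m ≤ n := by omega
    exact_mod_cast this
  have hm1 : (0 : ℝ) < m + 1 := by positivity
  have hb : bary (s ++ v :: t) - v = ((m : ℝ) + 1)⁻¹ • ((s ++ t).sum - (m : ℝ) • v) := by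
    have : (s ++ v :: t).sum = (s ++ t).sum + v := by simp; abel
    rw [bary, hlen, this]
    have hv : v = ((m : ℝ) + 1)⁻¹ • (((m : ℝ) + 1) • v) := by
      rw [smul_smul, inv_mul_cancel₀ hm1.ne', one_smul]
    nth_rewrite 2 [hv]
    rw [Nat.cast_add, Nat.cast_one, ← smul_sub, add_smul, one_smul]
    congr 1
    abel
  rw [dist_comm, dist_eq_norm, hb, norm_smul, norm_inv, Real.norm_of_nonneg hm1.le]
  calc ((m : ℝ) + 1)⁻¹ * ‖(s ++ t).sum - (m : ℝ) • v‖ ≤ ((m : ℝ) + 1)⁻¹ * (m * d) := by gcongr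
    _ = m / (m + 1) * d := by ring
    _ ≤ n / (n + 1) * d := by
      gcongr ?_ * d
      rw [div_le_div_iff₀ hm1 (by positivity)]
      nlinarith

/-- Barycentric subdivision of chains of simplices with `k` vertices. -/
noncomputable def subdiv : ℕ → ListChain E →ₗ[ZMod 2] ListChain E
  | 0 => LinearMap.id
  | k + 1 => linearCombination (ZMod 2) fun l => cone (bary l) (subdiv k (facets l))

theorem subdiv_succ_simplex (k : ℕ) (l : List E) :
    subdiv (k + 1) (simplex l) = cone (bary l) (subdiv k (facets l)) := by simp [subdiv]

theorem subdiv_mem {K : Set E} (hK : Convex ℝ K) (k : ℕ) {c : ListChain E}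
    (hc : c ∈ supp {l | l.length = k ∧ ∀ x ∈ l, x ∈ K}) :
    subdiv k c ∈ supp {l | l.length = k ∧ ∀ x ∈ l, x ∈ K} := by
  induction k generalizing c with
  | zero => exact hc
  | succ k ih =>
    refine map_mem_of_supp ?_ hc
    rintro l ⟨hl, hlK⟩
    rw [subdiv_succ_simplex]
    refine cone_mem (s := {l | l.length = k ∧ ∀ x ∈ l, x ∈ K}) ?_ (ih ?_)
    · rintro l' ⟨h1, h2⟩
      refine ⟨by simp [h1], ?_⟩
      intro x hx
      rcases List.mem_cons.1 hx with rfl | hx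
      · exact bary_mem hK (fun h => by simp [h] at hl) hlK
      · exact h2 x hx
    · refine supported_mono ?_ (facets_mem l)
      rintro l' ⟨h1, h2⟩
      exact ⟨by omega, fun x hx => hlK x (h2 x hx)⟩

theorem subdiv_mem_length (k : ℕ) {c : ListChain E} (hc : c ∈ supp {l | l.length = k}) :
    subdiv k c ∈ supp {l | l.length = k} := by
  simpa using subdiv_mem convex_univ k (c := c) (by simpa using hc)

theorem subdiv_mem_mesh {n : ℕ} {d : ℝ} (k : ℕ) (hk : k ≤ n + 1) {c : ListChain E}
    (hc : c ∈ supp {l | l.length = k ∧ ∀ x ∈ l, ∀ y ∈ l, dist x y ≤ d}) :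
    subdiv k c ∈ supp {l | l.length = k ∧ ∀ x ∈ l, ∀ y ∈ l, dist x y ≤ n / (n + 1) * d} := by
  induction k generalizing c with
  | zero =>
    refine supported_mono ?_ hc
    rintro l ⟨hl, -⟩
    exact ⟨hl, fun x hx => by simp [List.length_eq_zero_iff.1 hl] at hx⟩
  | succ k ih =>
    refine map_mem_of_supp ?_ hc
    rintro l ⟨hl, hld⟩
    have hne : l ≠ [] := fun h => by simp [h] at hl
    rw [subdiv_succ_simplex]
    have hmesh := ih (by omega) (c := facets l) (by
      refine supported_mono ?_ (facets_mem l)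
      rintro l' ⟨h1, h2⟩
      exact ⟨by omega, fun x hx y hy => hld x (h2 x hx) y (h2 y hy)⟩)
    have hball := subdiv_mem (convex_closedBall (bary l) (n / (n + 1) * d)) k (c := facets l) (by
      refine supported_mono ?_ (facets_mem l)
      rintro l' ⟨h1, h2⟩
      exact ⟨by omega, fun x hx => dist_bary_le hld (by omega) (h2 x hx)⟩)
    have hd : 0 ≤ n / (n + 1) * d := by
      obtain ⟨v, hv⟩ := List.exists_mem_of_ne_nil l hne
      exact dist_nonneg.trans (dist_bary_le hld (by omega) hv)
    have hboth := Submodule.mem_inf.2 ⟨hmesh, hball⟩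
    rw [← supported_inter] at hboth
    refine cone_mem ?_ hboth
    rintro l' ⟨⟨h1, h2⟩, -, h3⟩
    refine ⟨by simp [h1], ?_⟩
    intro x hx y hy
    rcases List.mem_cons.1 hx with rfl | hx <;> rcases List.mem_cons.1 hy with rfl | hy
    · simpa using hd
    · rw [dist_comm]; exact h3 y hy
    · exact h3 x hx
    · exact h2 x hx y hy

theorem boundary_subdiv (k : ℕ) {c : ListChain E} (hc : c ∈ supp {l | l.length = k + 1}) :
    boundary (subdiv (k + 1) c) = subdiv k (boundary c) := by
  induction k generalizing c with
  | zero =>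
    rw [← LinearMap.comp_apply, ← LinearMap.comp_apply]
    refine map_eq_of_supp ?_ hc
    intro l hl
    obtain ⟨x, rfl⟩ := List.length_eq_one_iff.1 hl
    simp [subdiv, facets]
  | succ k ih =>
    rw [← LinearMap.comp_apply, ← LinearMap.comp_apply]
    refine map_eq_of_supp ?_ hc
    intro l hl
    have hf : facets l ∈ supp {l : List E | l.length = k + 1} := by
      rw [← boundary_simplex]
      exact boundary_mem_length (simplex_mem_supp hl)
    rw [LinearMap.comp_apply, subdiv_succ_simplex, boundary_cone, ih hf, boundary_facets]
    simp

theorem antipode_subdiv (k : ℕ) (c : ListChain E) :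
    antipode (subdiv k c) = subdiv k (antipode c) := by
  induction k generalizing c with
  | zero => rfl
  | succ k ih =>
    rw [← LinearMap.comp_apply, ← LinearMap.comp_apply]
    refine map_eq_of_supp (s := Set.univ) ?_ (by simp)
    intro l _
    simp only [LinearMap.comp_apply, antipode_simplex, subdiv_succ_simplex, antipode_cone, ih,
      antipode_facets, bary_map_neg]

theorem iterate_subdiv_mem_length (k m : ℕ) {c : ListChain E}
    (hc : c ∈ supp {l | l.length = k}) : (subdiv k)^[m] c ∈ supp {l | l.length = k} := by
  induction m with
  | zero => exact hc
  | succ m ih => rw [Function.iterate_succ_apply']; exact subdiv_mem_length k ih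

theorem boundary_iterate_subdiv (k m : ℕ) {c : ListChain E}
    (hc : c ∈ supp {l | l.length = k + 1}) :
    boundary ((subdiv (k + 1))^[m] c) = (subdiv k)^[m] (boundary c) := by
  induction m with
  | zero => rfl
  | succ m ih =>
    rw [Function.iterate_succ_apply', Function.iterate_succ_apply',
      boundary_subdiv k (iterate_subdiv_mem_length _ m hc), ih]

theorem iterate_subdiv_add_antipode (k m : ℕ) (c : ListChain E) :
    (subdiv k)^[m] (c + antipode c) = (subdiv k)^[m] c + antipode ((subdiv k)^[m] c) := by
  induction m with
  | zero => rfl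
  | succ m ih =>
    simp only [Function.iterate_succ_apply', ih, map_add, antipode_subdiv]

theorem subdiv_one_vertex (x : E) : subdiv 1 (simplex [x]) = simplex [x] := by
  simp [subdiv, facets, bary]

end Subdivision

section CrossPolytope

variable {ι : Type*} [Fintype ι]

/-- The facet of the cross-polytope with sign vector `s`. -/
def crossFacet (s : ι → ℝ) : Set (ι → ℝ) := {x | (∀ i, 0 ≤ s i * x i) ∧ ∑ i, s i * x i = 1}

theorem convex_crossFacet (s : ι → ℝ) : Convex ℝ (crossFacet s) := by
  rintro x ⟨hx, hx'⟩ y ⟨hy, hy'⟩ a b ha hb hab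
  refine ⟨fun i => ?_, ?_⟩
  · have := add_nonneg (mul_nonneg ha (hx i)) (mul_nonneg hb (hy i))
    simp only [Pi.add_apply, Pi.smul_apply, smul_eq_mul]
    linarith
  · calc ∑ i, s i * (a • x + b • y) i = a * ∑ i, s i * x i + b * ∑ i, s i * y i := by
          rw [Finset.mul_sum, Finset.mul_sum, ← Finset.sum_add_distrib]
          refine Finset.sum_congr rfl fun i _ => ?_
          simp only [Pi.add_apply, Pi.smul_apply, smul_eq_mul]
          ring
      _ = 1 := by rw [hx', hy']; linarith

theorem sum_abs_of_mem_crossFacet {s : ι → ℝ} (hs : ∀ i, |s i| = 1) {x : ι → ℝ}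
    (hx : x ∈ crossFacet s) : ∑ i, |x i| = 1 := by
  rw [← hx.2]
  refine Finset.sum_congr rfl fun i _ => ?_
  rw [← abs_of_nonneg (hx.1 i), abs_mul, hs i, one_mul]

/-- Simplices with `k` vertices and mesh at most `d` inside a facet of the cross-polytope. -/
def crossSimplices (ι : Type*) [Fintype ι] (k : ℕ) (d : ℝ) : Set (List (ι → ℝ)) :=
  {l | (l.length = k ∧ ∀ x ∈ l, ∀ y ∈ l, dist x y ≤ d) ∧
    ∃ s : ι → ℝ, (∀ i, |s i| = 1) ∧ ∀ x ∈ l, x ∈ crossFacet s}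

theorem subdiv_mem_crossSimplices {n k : ℕ} (hk : k ≤ n + 1) {d : ℝ} {c : ListChain (ι → ℝ)}
    (hc : c ∈ supp (crossSimplices ι k d)) :
    subdiv k c ∈ supp (crossSimplices ι k (n / (n + 1) * d)) := by
  refine map_mem_of_supp ?_ hc
  rintro l ⟨hl, s, hs, hls⟩
  have h := Submodule.mem_inf.2 ⟨subdiv_mem_mesh k hk (simplex_mem_supp hl),
    subdiv_mem (convex_crossFacet s) k (simplex_mem_supp ⟨hl.1, hls⟩)⟩
  rw [← supported_inter] at h
  refine supported_mono ?_ h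
  rintro l' ⟨h1, h2⟩
  exact ⟨h1, s, hs, h2.2⟩

theorem iterate_subdiv_mem_crossSimplices {n k : ℕ} (hk : k ≤ n + 1) {d : ℝ}
    {c : ListChain (ι → ℝ)} (hc : c ∈ supp (crossSimplices ι k d)) (m : ℕ) :
    (subdiv k)^[m] c ∈ supp (crossSimplices ι k ((n / (n + 1)) ^ m * d)) := by
  induction m with
  | zero => simpa using hc
  | succ m ih =>
    rw [Function.iterate_succ_apply', pow_succ', mul_assoc]
    exact subdiv_mem_crossSimplices hk ih

/-- The boundary of the cross-polytope with vertices `± e i`, for `i < k`. -/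
noncomputable def crossSphere {E : Type*} [AddCommGroup E] (e : ℕ → E) : ℕ → ListChain E
  | 0 => simplex []
  | k + 1 => cone (e k) (crossSphere e k) + cone (-e k) (crossSphere e k)

theorem boundary_crossSphere {E : Type*} [AddCommGroup E] (e : ℕ → E) (k : ℕ) :
    boundary (crossSphere e k) = 0 := by
  induction k with
  | zero => simp [crossSphere, facets]
  | succ k ih => simp [crossSphere, boundary_cone, ih, add_self_eq_zero']

theorem antipode_crossSphere {E : Type*} [AddCommGroup E] (e : ℕ → E) (k : ℕ) :
    antipode (crossSphere e k) = crossSphere e k := by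
  induction k with
  | zero => simp [crossSphere]
  | succ k ih => simp [crossSphere, antipode_cone, ih, add_comm]

/-- The half of `crossSphere e (k + 1)` containing `e k`. -/
noncomputable def crossHemisphere {E : Type*} [AddCommGroup E] (e : ℕ → E) (k : ℕ) :
    ListChain E := cone (e k) (crossSphere e k)

theorem boundary_crossHemisphere {E : Type*} [AddCommGroup E] (e : ℕ → E) (k : ℕ) :
    boundary (crossHemisphere e (k + 1)) = crossHemisphere e k + antipode (crossHemisphere e k) := by
  rw [crossHemisphere, boundary_cone, boundary_crossSphere, map_zero, add_zero, crossHemisphere,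
    antipode_cone, antipode_crossSphere, crossSphere]

/-- Simplices with `k` vertices of the form `± e i`, with `i < k` and signs depending on `i`. -/
def signedSimplices {E : Type*} [AddCommGroup E] [Module ℝ E] (e : ℕ → E) (k : ℕ) :
    Set (List E) :=
  {l | l.length = k ∧ ∃ s : ℕ → ℝ, (∀ i, |s i| = 1) ∧ ∀ x ∈ l, ∃ i < k, x = s i • e i}

theorem cone_mem_signedSimplices {E : Type*} [AddCommGroup E] [Module ℝ E] {e : ℕ → E} {k : ℕ}
    {c : ListChain E} (hc : c ∈ supp (signedSimplices e k)) {t : ℝ} (ht : |t| = 1) :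
    cone (t • e k) c ∈ supp (signedSimplices e (k + 1)) := by
  refine cone_mem ?_ hc
  rintro l ⟨hl, s, hs, hls⟩
  refine ⟨by simp [hl], Function.update s k t, fun i => ?_, fun x hx => ?_⟩
  · rcases eq_or_ne i k with rfl | h
    · simpa using ht
    · simpa [h] using hs i
  · rcases List.mem_cons.1 hx with rfl | hx
    · exact ⟨k, by omega, by simp⟩
    · obtain ⟨i, hi, rfl⟩ := hls x hx
      exact ⟨i, by omega, by simp [hi.ne]⟩

theorem crossSphere_mem {E : Type*} [AddCommGroup E] [Module ℝ E] (e : ℕ → E) (k : ℕ) :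
    crossSphere e k ∈ supp (signedSimplices e k) := by
  induction k with
  | zero => exact simplex_mem_supp ⟨rfl, fun _ => 1, by simp, by simp⟩
  | succ k ih =>
    have h1 := cone_mem_signedSimplices ih (t := 1) (by simp)
    have h2 := cone_mem_signedSimplices ih (t := -1) (by simp)
    rw [one_smul] at h1
    rw [neg_one_smul] at h2
    exact add_mem h1 h2

theorem crossHemisphere_mem {n : ℕ} {e : ℕ → Fin (n + 1) → ℝ}
    (he : ∀ i : Fin (n + 1), e i = Pi.single i 1) {k : ℕ} (hk : k ≤ n) :
    crossHemisphere e k ∈ supp (crossSimplices (Fin (n + 1)) (k + 1) 2) := by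
  have h := cone_mem_signedSimplices (crossSphere_mem e k) (t := 1) (by simp)
  rw [one_smul] at h
  refine supported_mono ?_ h
  rintro l ⟨hl, s, hs, hls⟩
  have hl' : ∀ x ∈ l, ∃ i : Fin (n + 1), x = Pi.single i (s i) := by
    intro x hx
    obtain ⟨i, hi, rfl⟩ := hls x hx
    refine ⟨⟨i, by omega⟩, ?_⟩
    rw [he ⟨i, by omega⟩, ← Pi.single_smul, smul_eq_mul, mul_one]
  have hsq : ∀ i, s i * s i = 1 := fun i => by rw [← abs_mul_abs_self, hs, one_mul]
  refine ⟨⟨hl, ?_⟩, fun i => s i, fun i => hs i, ?_⟩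
  · intro x hx y hy
    obtain ⟨i, rfl⟩ := hl' x hx
    obtain ⟨j, rfl⟩ := hl' y hy
    refine (dist_le_norm_add_norm _ _).trans ?_
    rw [Pi.norm_single, Pi.norm_single, Real.norm_eq_abs, Real.norm_eq_abs, hs, hs]
    norm_num
  · intro x hx
    obtain ⟨i, rfl⟩ := hl' x hx
    refine ⟨fun j => ?_, ?_⟩
    · rcases eq_or_ne j i with rfl | hji
      · simp [hsq]
      · simp [hji]
    · simp [Pi.single_apply, hsq]

end CrossPolytope

end ListChain

open ListChain in
/-- **Borsuk–Ulam theorem** on the boundary of the cross-polytope. -/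
theorem exists_zero_of_odd_on_crossPolytope {n : ℕ} (F : (Fin (n + 1) → ℝ) → Fin n → ℝ)
    (hF : ContinuousOn F {x | ∑ i, |x i| = 1})
    (hodd : ∀ x, ∑ i, |x i| = 1 → F (-x) = -F x) :
    ∃ x, ∑ i, |x i| = 1 ∧ F x = 0 := by
  by_contra! hne
  set K : Set (Fin (n + 1) → ℝ) := {x | ∑ i, |x i| = 1} with hK
  have hKc : IsCompact K := by
    refine Metric.isCompact_of_isClosed_isBounded
      (isClosed_eq (by fun_prop) continuous_const) ?_
    refine (Metric.isBounded_closedBall (x := (0 : Fin (n + 1) → ℝ)) (r := 1)).subset ?_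
    intro x hx
    rw [mem_closedBall_zero_iff, pi_norm_le_iff_of_nonneg zero_le_one]
    intro i
    have hx' : ∑ i, |x i| = 1 := hx
    rw [← hx', Real.norm_eq_abs]
    exact Finset.single_le_sum (f := fun i => |x i|) (fun _ _ => abs_nonneg _)
      (Finset.mem_univ i)
  have hKne : K.Nonempty := ⟨Pi.single 0 1, by simp [hK, Pi.single_apply, apply_ite abs]⟩
  obtain ⟨z, hz, hmin⟩ := hKc.exists_isMinOn hKne hF.norm
  have hc : 0 < ‖F z‖ := norm_pos_iff.2 (hne z hz)
  obtain ⟨δ, hδ, hδF⟩ := Metric.uniformContinuousOn_iff.1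
    (hKc.uniformContinuousOn_of_continuous hF) _ hc
  -- equivariant signs of the coordinates of `F`, with an arbitrary equivariant choice at zeros
  let pos : ℕ → (Fin (n + 1) → ℝ) → Prop := fun k x =>
    if h : ∃ h : k < n, F x ⟨k, h⟩ ≠ 0 then 0 < F x ⟨k, h.fst⟩ else toLex x < toLex (-x)
  classical
  let σ : ℕ → (Fin (n + 1) → ℝ) → ZMod 2 := fun k x => if pos k x then 1 else 0
  have hσ : ∀ x ∈ K, ∀ k, σ k x + σ k (-x) = 1 := by
    intro x hx k
    have hiff : pos k (-x) ↔ ¬ pos k x := by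
      by_cases h : ∃ h : k < n, F x ⟨k, h⟩ ≠ 0
      · have h' : ∃ h : k < n, F (-x) ⟨k, h⟩ ≠ 0 := by
          simpa [hodd x hx] using h
        simp only [pos, dif_pos h, dif_pos h', hodd x hx, Pi.neg_apply, not_lt]
        obtain ⟨hk, h0⟩ := h
        constructor
        · intro h1; linarith
        · intro h1
          have := lt_of_le_of_ne h1 h0
          linarith
      · have h' : ¬ ∃ h : k < n, F (-x) ⟨k, h⟩ ≠ 0 := by
          simpa [hodd x hx] using h
        simp only [pos, dif_neg h, dif_neg h', neg_neg]
        refine ⟨fun h1 => not_lt.2 (le_of_lt h1),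
          fun h1 => lt_of_le_of_ne (not_lt.1 h1) fun h2 => ?_⟩
        have h3 : -x = x := toLex.injective h2
        have h4 : x = 0 := self_eq_neg.1 h3.symm
        have hx' : ∑ i, |x i| = 1 := hx
        simp [h4] at hx'
    by_cases hp : pos k x <;> simp [σ, hiff, hp]
  let e : ℕ → Fin (n + 1) → ℝ := fun i => if h : i < n + 1 then Pi.single ⟨i, h⟩ 1 else 0
  have he : ∀ i : Fin (n + 1), e i = Pi.single i 1 := fun i => by simp only [e, dif_pos i.2]
  have hρ : (n : ℝ) / (n + 1) < 1 := by rw [div_lt_one (by positivity)]; linarith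
  obtain ⟨m, hm⟩ := exists_pow_lt_of_lt_one (half_pos hδ) hρ
  let H : ℕ → ListChain (Fin (n + 1) → ℝ) := fun i => (subdiv (i + 1))^[m] (crossHemisphere e i)
  have hmem : ∀ i ≤ n, H i ∈
      supp (crossSimplices (Fin (n + 1)) (i + 1) ((n / (n + 1)) ^ m * 2)) := fun i hi =>
    iterate_subdiv_mem_crossSimplices (by omega) (crossHemisphere_mem he hi) m
  have hone : cup σ (H n) = 1 := by
    refine cup_hemisphere σ H (n := n) ?_ ?_ ?_ n le_rfl
    · intro i hi
      refine Finsupp.supported_mono ?_ (hmem i hi)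
      rintro l ⟨⟨hl, -⟩, s, hs, hls⟩
      exact ⟨hl, fun x hx => hσ x (sum_abs_of_mem_crossFacet hs (hls x hx))⟩
    · intro i hi
      have hlen : crossHemisphere e (i + 1) ∈ supp {l | l.length = i + 1 + 1} :=
        Finsupp.supported_mono (fun l h => h.1.1) (crossHemisphere_mem he (k := i + 1) hi)
      simp only [H]
      rw [boundary_iterate_subdiv _ _ hlen, boundary_crossHemisphere, iterate_subdiv_add_antipode]
    · have h0 : crossHemisphere e 0 = simplex [e 0] := by simp [crossHemisphere, crossSphere]
      simp only [H, h0, zero_add]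
      rw [Function.iterate_fixed (subdiv_one_vertex _), cup_simplex, cupVal]
  have hzero : cup σ (H n) ∈ (⊥ : Submodule (ZMod 2) (ZMod 2)) := by
    refine map_mem_of_supp ?_ (hmem n le_rfl)
    rintro l ⟨⟨hl, hd⟩, s, hs, hls⟩
    have hlK : ∀ x ∈ l, x ∈ K := fun x hx => sum_abs_of_mem_crossFacet hs (hls x hx)
    rw [cup_simplex, Submodule.mem_bot]
    obtain ⟨v, hv⟩ := List.exists_mem_of_ne_nil l (fun h => by simp [h] at hl)
    obtain ⟨k, hk⟩ : ∃ k, ‖F z‖ ≤ |F v k| := by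
      by_contra! hlt
      exact absurd (hmin (hlK v hv)) (not_le.2 ((pi_norm_lt_iff hc).2 hlt))
    have hclose : ∀ x ∈ l, |F x k - F v k| < ‖F z‖ := by
      intro x hx
      have h1 := hδF x (hlK x hx) v (hlK v hv) ((hd x hx v hv).trans_lt (by linarith))
      rw [dist_eq_norm] at h1
      exact (norm_le_pi_norm (F x - F v) k).trans_lt h1
    have hpos : ∀ x ∈ l, (pos k x ↔ 0 < F v k) := by
      intro x hx
      have h1 := abs_lt.1 (hclose x hx)
      have hsame : F x k ≠ 0 ∧ (0 < F x k ↔ 0 < F v k) := by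
        rcases le_abs.1 hk with h2 | h2
        · have : 0 < F x k := by linarith
          exact ⟨this.ne', by simp [this, hc.trans_le h2]⟩
        · have h3 : F x k < 0 := by linarith
          have h4 : F v k < 0 := by linarith
          exact ⟨h3.ne, iff_of_false h3.le.not_gt h4.le.not_gt⟩
      have h : ∃ h : (k : ℕ) < n, F x ⟨k, h⟩ ≠ 0 := ⟨k.2, hsame.1⟩
      simp only [pos, dif_pos h]
      exact hsame.2
    refine cupVal_eq_zero σ (k := k) l (by have := k.2; omega) fun x hx y hy => ?_
    simp only [σ, hpos x hx, hpos y hy]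
  rw [hone, Submodule.mem_bot] at hzero
  exact one_ne_zero hzero

theorem stmt_14 {X Y : Type*} [NormedAddCommGroup X] [NormedSpace ℝ X]
    [NormedAddCommGroup Y] [NormedSpace ℝ Y]
    (S : X →L[ℝ] Y) (n : ℕ) (N : X → Fin n → ℝ)
    (hN : ContinuousOn N (Metric.closedBall 0 1))
    (V : Subspace ℝ X) (hV : Module.finrank ℝ V = n + 1) :
    ∃ f ∈ V, ‖f‖ = 1 ∧ N f = N (-f) := by
  have : FiniteDimensional ℝ V := Module.finite_of_finrank_pos (by omega)
  let φ : (Fin (n + 1) → ℝ) ≃ₗ[ℝ] V := LinearEquiv.ofFinrankEq _ _ (by simp [hV])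
  let ψ : (Fin (n + 1) → ℝ) →ₗ[ℝ] X := V.subtype ∘ₗ φ.toLinearMap
  have hψ : Continuous ψ := ψ.continuous_of_finiteDimensional
  have hψ0 : ∀ x, ∑ i, |x i| = 1 → ψ x ≠ 0 := by
    intro x hx h
    have h0 : x = 0 := by simpa [ψ] using h
    simp [h0] at hx
  let u : (Fin (n + 1) → ℝ) → X := fun x => ‖ψ x‖⁻¹ • ψ x
  have hu1 : ∀ x, ∑ i, |x i| = 1 → ‖u x‖ = 1 := fun x hx => norm_smul_inv_norm (𝕜 := ℝ) (hψ0 x hx)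
  have huneg : ∀ x, u (-x) = -u x := fun x => by simp [u]
  have hu : ContinuousOn u {x | ∑ i, |x i| = 1} :=
    (hψ.norm.continuousOn.inv₀ fun x hx => norm_ne_zero_iff.2 (hψ0 x hx)).smul hψ.continuousOn
  obtain ⟨x, hx, hFx⟩ := exists_zero_of_odd_on_crossPolytope (fun x => N (u x) - N (-u x))
    ((hN.comp hu fun x hx => by simp [hu1 x hx]).sub
      (hN.comp hu.neg fun x hx => by simp [hu1 x hx]))
    (fun x _ => by simp [huneg])
  exact ⟨u x, V.smul_mem _ (φ x).2, hu1 x hx, sub_eq_zero.1 hFx⟩
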